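/- Let K be a nonempty half-plane hull and suppose Ω = ℍ \ K is a (β,C₀)-Hölder domain. Then there exist a point z₀ ∈ Ω with dist(z₀,K) ≤ 200·diam(K) and Im(z₀) ≥ 100·diam(K), and a constant C > 0 depending only on β and C₀, such that ρ_Ω(z₀,z) ≤ (1/β)·log( max{diam(K)^β, diam(K)} / δ_Ω(z) ) + C for every z ∈ Ω that lies on a hyperbolic geodesic segment from z₀ to a point of D_K, i.e., every z ∈ Ω for which there exists z₁ ∈ D_K with ρ_Ω(z₀,z) + ρ_Ω(z,z₁) = ρ_Ω(z₀,z₁). -/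

import Mathlib

open Set Metric Filter Bornology Complex Function

noncomputable section

/-- The upper half-plane as a subset of `ℂ`. -/
def UHP : Set ℂ := {z : ℂ | 0 < z.im}

/-- `K` is a half-plane hull: a bounded subset of the upper half-plane whose
complement in the upper half-plane is a simply connected domain. -/
def IsHull (K : Set ℂ) : Prop :=
  IsBounded K ∧ K ⊆ UHP ∧ IsOpen (UHP \ K) ∧ IsConnected (UHP \ K) ∧
    SimplyConnectedSpace ↥(UHP \ K)

/-- `f` is the hydrodynamic conformal map of the hull `K`: a conformal bijection
from the upper half-plane onto `UHP \ K` with `f z - z → 0` as `|z| → ∞` in `UHP`. -/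
def IsHydroMap (K : Set ℂ) (f : ℂ → ℂ) : Prop :=
  DifferentiableOn ℂ f UHP ∧ InjOn f UHP ∧ f '' UHP = UHP \ K ∧
    Tendsto (fun z => f z - z) (cobounded ℂ ⊓ 𝓟 UHP) (nhds (0 : ℂ))

/-- `f` is the hydrodynamic map of `K` and `g` is its inverse. -/
def IsHydroPair (K : Set ℂ) (f g : ℂ → ℂ) : Prop :=
  IsHydroMap K f ∧ InvOn g f UHP (UHP \ K)

/-- `K` has half-plane capacity `a`, computed via its hydrodynamic map `f`:
`z * (z - f z) → a` as `|z| → ∞` in `UHP`. -/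
def HasHcap (K : Set ℂ) (f : ℂ → ℂ) (a : ℝ) : Prop :=
  Tendsto (fun z => z * (z - f z)) (cobounded ℂ ⊓ 𝓟 UHP) (nhds (a : ℂ))

/-- The `(β, C₀)`-Hölder condition for a map defined on the upper half-plane. -/
def IsHolder (f : ℂ → ℂ) (β C₀ : ℝ) : Prop :=
  ∀ z ∈ UHP, ∀ z' ∈ UHP, dist (f z) (f z') ≤ C₀ * max (dist z z' ^ β) (dist z z')

/-- The Poincaré hyperbolic distance on the upper half-plane. -/
def rhoH (z w : ℂ) : ℝ :=
  2 * Real.arsinh (dist z w / (2 * Real.sqrt (z.im * w.im)))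

/-- The hyperbolic distance on a simply connected domain `Ω`, transported through a
conformal bijection `φ : UHP → Ω` (independent of the choice of `φ`). -/
def rhoVia (φ : ℂ → ℂ) (z w : ℂ) : ℝ :=
  rhoH (invFunOn φ UHP z) (invFunOn φ UHP w)

/-- `log⁺ x = max (log x) 0`. -/
def posLog (x : ℝ) : ℝ := max (Real.log x) 0

/-- Internal distance between `A` and `B` inside `Ω`: the infimum of diameters of
connected subsets of `Ω` meeting both `A` and `B`. -/
def distIn (Ω A B : Set ℂ) : ℝ :=
  sInf {d : ℝ | ∃ E : Set ℂ, E ⊆ Ω ∧ IsConnected E ∧ (E ∩ A).Nonempty ∧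
    (E ∩ B).Nonempty ∧ d = Metric.diam E}

/-- Internal diameter of `A` inside `Ω`. -/
def diamIn (Ω A : Set ℂ) : ℝ :=
  sSup {d : ℝ | ∃ a ∈ A, ∃ b ∈ A, d = distIn Ω {a} {b}}

/-- An `L`-John curve in `Ω` with tip `z`, parametrized on `[0,1)` (the base-point,
which is not required to lie in `Ω`, corresponds to the missing endpoint). -/
def IsJohnCurve (Ω : Set ℂ) (L : ℝ) (α : ℝ → ℂ) (z : ℂ) : Prop :=
  ContinuousOn α (Ico 0 1) ∧ InjOn α (Ico 0 1) ∧ α 0 = z ∧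
    MapsTo α (Ico 0 1) Ω ∧
    ∀ t ∈ Ico (0:ℝ) 1, Metric.diam (α '' Icc 0 t) ≤ L * infDist (α t) (frontier Ω)

/-- An `L`-John curve in `Ω` with tip `z` and base-point `∞`, parametrized on `[0,∞)`. -/
def IsJohnCurveInfty (Ω : Set ℂ) (L : ℝ) (α : ℝ → ℂ) (z : ℂ) : Prop :=
  ContinuousOn α (Ici 0) ∧ InjOn α (Ici 0) ∧ α 0 = z ∧
    MapsTo α (Ici 0) Ω ∧ Tendsto α atTop (cobounded ℂ) ∧
    ∀ t ∈ Ici (0:ℝ), Metric.diam (α '' Icc 0 t) ≤ L * infDist (α t) (frontier Ω)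


lemma isOpen_UHP : IsOpen UHP := isOpen_lt continuous_const Complex.continuous_im

lemma convex_UHP : Convex ℝ UHP := convex_halfSpace_im_gt 0

lemma isPreconnected_UHP : IsPreconnected UHP := convex_UHP.isPreconnected

lemma img_open {f : ℂ → ℂ} (hf : DifferentiableOn ℂ f UHP) (hi : InjOn f UHP) :
    ∀ s ⊆ UHP, IsOpen s → IsOpen (f '' s) := by
  rcases (hf.analyticOnNhd isOpen_UHP).is_constant_or_isOpen isPreconnected_UHP with ⟨w, hw⟩ | h
  · exfalso
    have h1 : (Complex.I) ∈ UHP := by simp [UHP]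
    have h2 : (2 * Complex.I) ∈ UHP := by simp [UHP]
    have := hi h1 h2 ((hw _ h1).trans (hw _ h2).symm)
    have h3 := congrArg Complex.im this
    simp at h3
  · exact h

lemma inv_cont {f g : ℂ → ℂ} {V : Set ℂ} (hf : DifferentiableOn ℂ f UHP) (hi : InjOn f UHP)
    (hV : f '' UHP = V) (hg : LeftInvOn g f UHP) : ContinuousOn g V := by
  subst hV
  rintro _ ⟨w, hw, rfl⟩
  apply ContinuousAt.continuousWithinAt
  rw [ContinuousAt, hg hw]
  intro s hs
  have h1 : s ∩ UHP ∈ nhds w := inter_mem hs (isOpen_UHP.mem_nhds hw)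
  obtain ⟨t, hts, hto, hwt⟩ := _root_.mem_nhds_iff.1 h1
  have h2 : IsOpen (f '' t) := img_open hf hi t (fun x hx => (hts hx).2) hto
  refine Filter.mem_map.2 (mem_of_superset (h2.mem_nhds ⟨w, hwt, rfl⟩) ?_)
  rintro _ ⟨x, hx, rfl⟩
  show g (f x) ∈ s
  rw [hg (hts hx).2]
  exact (hts hx).1

lemma inv_holo {f g : ℂ → ℂ} {V : Set ℂ} (hf : DifferentiableOn ℂ f UHP) (hi : InjOn f UHP)
    (hV : f '' UHP = V) (hg : LeftInvOn g f UHP) : DifferentiableOn ℂ g V := by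
  have hc := inv_cont hf hi hV hg
  have hVo : IsOpen V := hV ▸ img_open hf hi _ Subset.rfl isOpen_UHP
  have hr : ∀ z ∈ V, f (g z) = z := by
    subst hV; rintro _ ⟨w, hw, rfl⟩; rw [hg hw]
  have hm : ∀ z ∈ V, g z ∈ UHP := by
    subst hV; rintro _ ⟨w, hw, rfl⟩; rwa [hg hw]
  have key : ∀ z ∈ V, deriv f (g z) ≠ 0 → DifferentiableAt ℂ g z := by
    intro z hz h
    have h1 : HasDerivAt f (deriv f (g z)) (g z) :=
      (hf.differentiableAt (isOpen_UHP.mem_nhds (hm z hz))).hasDerivAt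
    refine (HasDerivAt.of_local_left_inverse (hc.continuousAt (hVo.mem_nhds hz)) h1 h ?_).differentiableAt
    filter_upwards [hVo.mem_nhds hz] with y hy using hr y hy
  intro z hz
  apply DifferentiableAt.differentiableWithinAt
  have hd : AnalyticAt ℂ (deriv f) (g z) :=
    ((hf.analyticOnNhd isOpen_UHP) _ (hm z hz)).deriv
  have hgc : ContinuousAt g z := hc.continuousAt (hVo.mem_nhds hz)
  rcases hd.eventually_eq_zero_or_eventually_ne_zero with h0 | h0
  · exfalso
    obtain ⟨ε, hε, hb⟩ := Metric.eventually_nhds_iff_ball.1 (h0.and (isOpen_UHP.mem_nhds (hm z hz)))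
    have hconst : ∀ y ∈ ball (g z) ε, f y = f (g z) := by
      intro y hy
      refine (convex_ball (g z) ε).is_const_of_fderivWithin_eq_zero (𝕜 := ℂ) (hf.mono fun x hx => (hb x hx).2) ?_ hy (mem_ball_self hε)
      intro x hx
      rw [fderivWithin_of_isOpen isOpen_ball hx]
      ext
      simpa using (hb x hx).1
    have hy : g z + (ε/2 : ℝ) ∈ ball (g z) ε := by
      simp [abs_of_pos hε]; linarith
    have := hi (hb _ hy).2 (hm z hz) (hconst _ hy)
    simp at this
    linarith
  · apply (analyticAt_of_differentiable_on_punctured_nhds_of_continuousAt _ hgc).differentiableAt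
    rw [eventually_nhdsWithin_iff] at h0 ⊢
    filter_upwards [hgc.eventually h0, hVo.mem_nhds hz] with y hy hyV hne
    refine key y hyV (hy ?_)
    intro h
    apply hne
    have := congrArg f h
    rw [hr y hyV, hr z hz] at this
    exact this

/-- points of a hull are not higher than its diameter -/
lemma hull_im_le {K : Set ℂ} (hK : IsHull K) {p : ℂ} (hp : p ∈ K) : p.im ≤ Metric.diam K := by
  obtain ⟨hb, hU, ho, hc, hs⟩ := hK
  by_contra! hlt
  obtain ⟨r, hr1, hr2⟩ := exists_between hlt
  have hr0 : 0 < r := lt_of_le_of_lt Metric.diam_nonneg hr1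
  have hs' : IsSimplyConnected (UHP \ K) := by
    rw [IsSimplyConnected]; exact hs
  obtain ⟨L, hL, hexp⟩ := exists_continuousOn_eqOn_exp_comp hs' ho
    (g := fun z => z - p) (by fun_prop) (by
      rintro ⟨z, hz, h⟩
      have : z = p := sub_eq_zero.1 h
      exact hz.2 (this ▸ hp))
  have hcirc : ∀ θ : ℝ, circleMap p r θ ∈ UHP \ K := by
    intro θ
    have hd : dist (circleMap p r θ) p = r := by
      exact mem_sphere.1 (circleMap_mem_sphere p hr0.le θ)
    refine ⟨?_, fun h => ?_⟩
    · have h1 : |(circleMap p r θ - p).im| ≤ r := by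
        refine (Complex.abs_im_le_norm _).trans ?_
        rw [← dist_eq_norm, hd]
      rw [Complex.sub_im, abs_le] at h1
      show 0 < (circleMap p r θ).im
      linarith [h1.1]
    · have := Metric.dist_le_diam_of_mem hb h hp
      linarith
  let ℓ : ℝ → ℂ := fun θ => L (circleMap p r θ) - θ * I - Real.log r
  have hℓ : Continuous ℓ := by
    have : Continuous fun θ => L (circleMap p r θ) :=
      hL.comp_continuous (continuous_circleMap p r) hcirc
    show Continuous fun θ : ℝ => L (circleMap p r θ) - θ * I - Real.log r
    exact (this.sub (continuous_ofReal.mul continuous_const)).sub continuous_const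
  have hℓe : ∀ θ, Complex.exp (ℓ θ) = 1 := by
    intro θ
    have := hexp (hcirc θ)
    simp only [Function.comp, circleMap, add_sub_cancel_left] at this
    simp only [ℓ, circleMap]
    rw [Complex.exp_sub, Complex.exp_sub, this, ← Complex.ofReal_exp, Real.exp_log hr0]
    have h1 : (r : ℂ) ≠ 0 := by exact_mod_cast hr0.ne'
    have h2 := Complex.exp_ne_zero (θ * I)
    field_simp
  have hn : ∀ θ, ∃ n : ℤ, ((ℓ θ).im / (2 * Real.pi)) = n := by
    intro θ
    obtain ⟨n, hn⟩ := Complex.exp_eq_one_iff.1 (hℓe θ)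
    refine ⟨n, ?_⟩
    rw [hn]
    have : Real.pi ≠ 0 := Real.pi_ne_zero
    simp
  choose n hn using hn
  have hncont : Continuous n := by
    have : Continuous (fun θ => (n θ : ℝ)) := by
      simp_rw [← hn]
      fun_prop
    exact Int.isClosedEmbedding_coe_real.isEmbedding.continuous_iff.2 this
  have h0 : n 0 = n (2 * Real.pi) := PreconnectedSpace.constant inferInstance hncont
  have h1 := hn 0
  have h2 := hn (2 * Real.pi)
  rw [← h0, ← h1] at h2
  have hper : circleMap p r (2 * Real.pi) = circleMap p r 0 := by
    have := periodic_circleMap p r 0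
    simpa using this
  simp only [ℓ, hper] at h2
  have hpi := Real.pi_pos
  field_simp at h2
  simp at h2

/-- maximum principle for the imaginary part on the upper half plane -/
lemma im_nonpos_of_boundary {q : ℂ → ℂ} (hq : DifferentiableOn ℂ q UHP)
    (hinf : Tendsto q (cobounded ℂ ⊓ 𝓟 UHP) (nhds (0 : ℂ)))
    (hbd : ∀ x : ℂ, x.im = 0 → ∀ ε > 0, ∀ᶠ w in nhdsWithin x UHP, (q w).im < ε) :
    ∀ w ∈ UHP, (q w).im ≤ 0 := by
  intro w hw
  by_contra! hpos
  set ε := (q w).im with hε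
  let S : Set ℂ := {z | z ∈ UHP ∧ ε ≤ (q z).im}
  have hinf' : ∀ᶠ z in cobounded ℂ ⊓ 𝓟 UHP, (q z).im < ε := by
    have h1 : Tendsto (fun z => (q z).im) (cobounded ℂ ⊓ 𝓟 UHP) (nhds 0) := by
      exact (Complex.continuous_im.tendsto (0:ℂ)).comp hinf
    exact h1.eventually (gt_mem_nhds hpos)
  rw [eventually_inf_principal] at hinf'
  have hSb : IsBounded S := by
    rw [isBounded_def]
    filter_upwards [hinf'] with z hz hzS
    exact absurd (hz hzS.1) (not_lt.2 hzS.2)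
  have hSc : IsClosed S := by
    rw [← closure_subset_iff_isClosed]
    intro x hx
    have him : 0 ≤ x.im := by
      have : closure S ⊆ {z : ℂ | 0 ≤ z.im} :=
        closure_minimal (fun z hz => le_of_lt (show 0 < z.im from hz.1)) (isClosed_le continuous_const Complex.continuous_im)
      exact this hx
    have hfr : ∃ᶠ z in nhds x, z ∈ S := mem_closure_iff_frequently.1 hx
    rcases him.eq_or_lt with h0 | h0
    · exfalso
      have := hbd x h0.symm ε hpos
      rw [eventually_nhdsWithin_iff] at this
      obtain ⟨z, hz, hzS⟩ := (this.and_frequently hfr).exists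
      exact absurd (hz hzS.1) (not_lt.2 hzS.2)
    · refine ⟨h0, ?_⟩
      have hcont : ContinuousAt (fun z => (q z).im) x :=
        Complex.continuous_im.continuousAt.comp
          (hq.continuousOn.continuousAt (isOpen_UHP.mem_nhds h0))
      by_contra! hl
      obtain ⟨z, hz, hzS⟩ := ((hcont.eventually (gt_mem_nhds hl)).and_frequently hfr).exists
      exact absurd hz (not_lt.2 hzS.2)
  have hSk : IsCompact S := Metric.isCompact_of_isClosed_isBounded hSc hSb
  obtain ⟨c, hcS, hcm⟩ := hSk.exists_isMaxOn ⟨w, hw, le_rfl⟩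
    (f := fun z => (q z).im) (Complex.continuous_im.comp_continuousOn
      (hq.continuousOn.mono fun z hz => hz.1))
  have hmax : IsMaxOn (norm ∘ fun z => Complex.exp (-I * q z)) UHP c := by
    intro z hz
    simp only [Function.comp, mem_ofPred_eq, Complex.norm_exp]
    simp
    by_cases hzS : z ∈ S
    · exact hcm hzS
    · have : (q z).im < ε := by
        by_contra! h; exact hzS ⟨hz, h⟩
      exact this.le.trans hcS.2
  have hconst := Complex.norm_eqOn_of_isPreconnected_of_isMaxOn isPreconnected_UHP isOpen_UHP
    (f := fun z => Complex.exp (-I * q z)) (by fun_prop) hcS.1 hmax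
  have hall : ∀ z ∈ UHP, (q z).im = (q c).im := by
    intro z hz
    have := hconst hz
    simp only [Function.comp, Function.const, Complex.norm_exp, Real.exp_eq_exp] at this
    simpa using this
  have : UHP ⊆ S := fun z hz => ⟨hz, by rw [hall z hz]; exact hcS.2⟩
  have hb := hSb.subset this
  obtain ⟨M, hM⟩ := hb.exists_norm_le
  have h1 : ((|M| + 1 : ℝ) * I : ℂ) ∈ UHP := by
    simp [UHP]; positivity
  have h2 := hM _ h1
  rw [norm_mul, Complex.norm_I, mul_one, Complex.norm_real, Real.norm_eq_abs,
    abs_of_pos (by positivity)] at h2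
  linarith [le_abs_self M]

lemma im_le_im_f {K : Set ℂ} {f : ℂ → ℂ} (hf : IsHydroMap K f) :
    ∀ w ∈ UHP, w.im ≤ (f w).im := by
  obtain ⟨hd, -, himg, hlim⟩ := hf
  intro w hw
  have := im_nonpos_of_boundary (q := fun w => w - f w) (by fun_prop) (by
      have := hlim.neg
      simpa using this) (by
      intro x hx ε hε
      have h1 : ∀ᶠ w : ℂ in nhds x, w.im < ε :=
        Complex.continuous_im.continuousAt.eventually (gt_mem_nhds (by rw [hx]; exact hε))
      rw [eventually_nhdsWithin_iff]
      filter_upwards [h1] with w h1 hw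
      have : f w ∈ UHP := (himg ▸ mem_image_of_mem f hw : f w ∈ UHP \ K).1
      have h2 : 0 < (f w).im := this
      simp
      linarith) w hw
  simp at this
  exact this

lemma f_leaves_compact {K Q : Set ℂ} {f g : ℂ → ℂ} (hf : IsHydroPair K f g) (hQ : IsCompact Q)
    (hQK : Q ⊆ UHP \ K) {x : ℂ} (hx : x.im = 0) :
    ∀ᶠ w in nhdsWithin x UHP, f w ∉ Q := by
  obtain ⟨⟨hd, hi, himg, -⟩, hg⟩ := hf
  have hc := inv_cont hd hi himg hg.1
  have hgQ : IsClosed (g '' Q) := (hQ.image_of_continuousOn (hc.mono hQK)).isClosed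
  have hxn : x ∉ g '' Q := by
    rintro ⟨z, hz, rfl⟩
    obtain ⟨w, hw, hwz⟩ := (himg ▸ hQK hz : z ∈ f '' UHP)
    rw [← hwz, hg.1 hw] at hx
    exact (ne_of_gt hw) hx
  rw [eventually_nhdsWithin_iff]
  filter_upwards [hgQ.isOpen_compl.mem_nhds hxn] with w hw hwU hfw
  exact hw ⟨f w, hfw, hg.1 hwU⟩

lemma f_bdd {f : ℂ → ℂ} {β C₀ : ℝ} (hβ0 : 0 < β) (hC : 0 < C₀) (hH : IsHolder f β C₀) (R : ℝ) :
    ∃ M : ℝ, ∀ w ∈ UHP, ‖w‖ ≤ R → ‖f w‖ ≤ M := by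
  have hI : I ∈ UHP := by simp [UHP]
  refine ⟨C₀ * max ((R+1) ^ β) (R+1) + ‖f I‖, fun w hw hwR => ?_⟩
  have h1 := hH w hw I hI
  have h2 : dist w I ≤ R + 1 := by
    rw [dist_eq_norm]
    refine (norm_sub_le _ _).trans ?_
    simp [hwR]
  have h3 : dist w I ^ β ≤ (R+1) ^ β := Real.rpow_le_rpow dist_nonneg h2 hβ0.le
  have h4 : ‖f w‖ ≤ dist (f w) (f I) + ‖f I‖ := by
    rw [dist_eq_norm]
    have := norm_add_le (f w - f I) (f I)
    simpa using this
  have h5 := mul_le_mul_of_nonneg_left (max_le_max h3 h2) hC.le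
  linarith

lemma J_im (x₀ r : ℝ) (z : ℂ) :
    (z + (r:ℂ)^2 / (z - x₀)).im = z.im * (1 - r^2 / ‖z - x₀‖^2) := by
  have : (r:ℂ)^2 / (z - x₀) = ((r^2 : ℝ) : ℂ) * (z - x₀)⁻¹ := by push_cast; rw [div_eq_mul_inv]
  rw [this, Complex.add_im, Complex.im_ofReal_mul, Complex.inv_im, Complex.normSq_eq_norm_sq]
  simp
  ring

lemma J_im_f_le {K : Set ℂ} {f g : ℂ → ℂ} {β C₀ : ℝ} (hβ0 : 0 < β) (hC : 0 < C₀)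
    (hf : IsHydroPair K f g) (hH : IsHolder f β C₀) {x₀ r : ℝ} (hr : 0 < r)
    (hK : K ⊆ closedBall (x₀ : ℂ) r) :
    ∀ w ∈ UHP, (f w).im * (1 - r^2 / ‖f w - x₀‖^2) ≤ w.im := by
  have hf' := hf
  obtain ⟨⟨hd, hi, himg, hlim⟩, hg⟩ := hf
  have hfU : ∀ w ∈ UHP, f w ∈ UHP \ K := fun w hw => himg ▸ mem_image_of_mem f hw
  have hne : ∀ z ∈ UHP, z - (x₀:ℂ) ≠ 0 := by
    intro z hz h
    have h1 := congrArg Complex.im h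
    simp at h1
    exact (ne_of_gt hz) h1
  intro w hw
  have key := im_nonpos_of_boundary
    (q := fun w => (f w - w) + (r:ℂ)^2 / (f w - x₀)) ?_ ?_ ?_ w hw
  · have := J_im x₀ r (f w)
    rw [Complex.add_im] at this
    rw [Complex.add_im, Complex.sub_im] at key
    linarith
  · have h1 : ∀ w ∈ UHP, f w - (x₀:ℂ) ≠ 0 := fun w hw => hne _ (hfU w hw).1
    refine (hd.sub differentiableOn_id).add (DifferentiableOn.div (by fun_prop) (by fun_prop) h1)
  · have h1 : Tendsto (fun w => f w - x₀) (cobounded ℂ ⊓ 𝓟 UHP) (cobounded ℂ) := by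
      rw [← tendsto_norm_atTop_iff_cobounded]
      have h2 : Tendsto (fun w : ℂ => ‖w‖ - (1 + |x₀|)) (cobounded ℂ ⊓ 𝓟 UHP) atTop :=
        (tendsto_atTop_add_const_right _ _ tendsto_norm_cobounded_atTop).mono_left inf_le_left
      refine tendsto_atTop_mono' _ ?_ h2
      have h3 : ∀ᶠ w in cobounded ℂ ⊓ 𝓟 UHP, ‖f w - w‖ < 1 := by
        have := hlim.norm
        rw [norm_zero] at this
        exact this.eventually (gt_mem_nhds one_pos)
      filter_upwards [h3] with w h3
      have h4 : w = (f w - x₀) - (f w - w) + x₀ := by ring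
      have h5 : ‖w‖ ≤ ‖f w - x₀‖ + ‖f w - w‖ + ‖(x₀:ℂ)‖ := by
        conv_lhs => rw [h4]
        exact (norm_add_le _ _).trans (add_le_add_left (norm_sub_le _ _) _)
      rw [Complex.norm_real, Real.norm_eq_abs] at h5
      linarith
    have h2 : Tendsto (fun w => (r:ℂ)^2 / (f w - x₀)) (cobounded ℂ ⊓ 𝓟 UHP) (nhds 0) := by
      have := (tendsto_inv₀_cobounded.comp h1).const_mul ((r:ℂ)^2)
      simpa [div_eq_mul_inv, Function.comp_def] using this
    simpa using hlim.add h2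
  · intro x hx ε hε
    obtain ⟨M, hM⟩ := f_bdd hβ0 hC hH (‖x‖ + 1)
    let Q : Set ℂ := {z | ε ≤ z.im ∧ ε * ‖z - x₀‖^2 ≤ z.im * (‖z - x₀‖^2 - r^2)} ∩ closedBall 0 M
    have hQc : IsCompact Q := by
      refine (isCompact_closedBall (0:ℂ) M).inter_left ?_
      have c1 : IsClosed {z : ℂ | ε ≤ z.im} := isClosed_le (by fun_prop) (by fun_prop)
      have c2 : IsClosed {z : ℂ | ε * ‖z - x₀‖^2 ≤ z.im * (‖z - x₀‖^2 - r^2)} :=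
        isClosed_le (by fun_prop) (by fun_prop)
      exact c1.inter c2
    have hQK : Q ⊆ UHP \ K := by
      rintro z ⟨⟨h1, h2⟩, -⟩
      have hz : z ∈ UHP := lt_of_lt_of_le hε h1
      refine ⟨hz, fun hzK => ?_⟩
      have h3 : ‖z - x₀‖ ≤ r := by simpa [dist_eq_norm] using hK hzK
      have h4 : 0 < ‖z - x₀‖ := norm_pos_iff.2 (hne z hz)
      have h5 : ‖z - x₀‖^2 - r^2 ≤ 0 := by nlinarith
      have h6 : 0 < ε * ‖z - x₀‖^2 := by positivity
      have h7 : 0 < z.im := hz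
      nlinarith
    have hnear : ∀ᶠ w in nhdsWithin x UHP, ‖w‖ < ‖x‖ + 1 :=
      nhdsWithin_le_nhds (continuous_norm.continuousAt.eventually (gt_mem_nhds (by linarith)))
    filter_upwards [f_leaves_compact hf' hQc hQK hx, hnear, self_mem_nhdsWithin] with w h1 h2 h3
    have hJ := J_im x₀ r (f w)
    rw [Complex.add_im] at hJ
    rw [Complex.add_im, Complex.sub_im]
    by_contra! h4
    have hw0 : 0 < w.im := h3
    have hf0 : 0 < (f w).im := (hfU w h3).1
    have h5 : ε ≤ (f w).im * (1 - r^2 / ‖f w - x₀‖^2) := by linarith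
    have h6 : 0 < ‖f w - x₀‖ := norm_pos_iff.2 (hne _ (hfU w h3).1)
    apply h1
    refine ⟨⟨?_, ?_⟩, ?_⟩
    · have : 0 ≤ r^2 / ‖f w - x₀‖^2 := by positivity
      nlinarith
    · have h7 := mul_le_mul_of_nonneg_right h5 (sq_nonneg ‖f w - x₀‖)
      have h8 : (f w).im * (1 - r^2 / ‖f w - x₀‖^2) * ‖f w - x₀‖^2
          = (f w).im * (‖f w - x₀‖^2 - r^2) := by field_simp
      linarith
    · simpa using hM w h3 h2.le

lemma deriv_le_of_im {F : ℂ → ℂ} {z : ℂ} {ρ M : ℝ} (hρ : 0 < ρ) (hM : 0 < M)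
    (hF : ∀ ζ ∈ closedBall z ρ, DifferentiableAt ℂ F ζ)
    (h0 : ∀ ζ ∈ closedBall z ρ, 0 ≤ (F ζ).im) (h1 : ∀ ζ ∈ closedBall z ρ, (F ζ).im ≤ M) :
    ‖deriv F z‖ ≤ 3 * M / ρ := by
  let E : ℂ → ℂ := fun ζ => Complex.exp (-I / M * F ζ)
  have hE : ∀ ζ ∈ closedBall z ρ, DifferentiableAt ℂ E ζ := by
    intro ζ hζ
    exact ((hF ζ hζ).const_mul _).cexp
  have hn : ∀ ζ, ‖E ζ‖ = Real.exp ((F ζ).im / M) := by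
    intro ζ
    simp only [E, Complex.norm_exp]
    congr 1
    have : -I / (M:ℂ) * F ζ = ((M⁻¹ : ℝ) : ℂ) * (-I * F ζ) := by push_cast; ring
    rw [this, Complex.re_ofReal_mul]
    simp
    ring
  have hz : z ∈ closedBall z ρ := mem_closedBall_self hρ.le
  have hc : ‖deriv E z‖ ≤ 3 / ρ := by
    refine Complex.norm_deriv_le_of_forall_mem_sphere_norm_le hρ ?_ ?_
    · apply DifferentiableOn.diffContOnCl_ball (U := closedBall z ρ) _ Subset.rfl
      exact fun ζ hζ => (hE ζ hζ).differentiableWithinAt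
    · intro ζ hζ
      rw [hn]
      have : (F ζ).im / M ≤ 1 := by rw [div_le_one hM]; exact h1 ζ (sphere_subset_closedBall hζ)
      exact (Real.exp_le_exp.2 this).trans (by linarith [Real.exp_one_lt_d9])
  have hd : deriv E z = E z * (-I / M * deriv F z) :=
    (((hF z hz).hasDerivAt.const_mul (-I / (M:ℂ))).cexp).deriv
  rw [hd, norm_mul, norm_mul, norm_div, norm_neg, Complex.norm_I, Complex.norm_real,
    Real.norm_eq_abs, abs_of_pos hM, hn] at hc
  have h2 : 1 ≤ Real.exp ((F z).im / M) := Real.one_le_exp (div_nonneg (h0 z hz) hM.le)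
  have h3 : 1 / M * ‖deriv F z‖ ≤ 3 / ρ :=
    (le_mul_of_one_le_left (by positivity) h2).trans hc
  have h4 := mul_le_mul_of_nonneg_left h3 hM.le
  have h5 : M * (1 / M * ‖deriv F z‖) = ‖deriv F z‖ := by field_simp
  rw [h5] at h4
  refine h4.trans (le_of_eq (by ring))

lemma g_near_id {K : Set ℂ} {f g : ℂ → ℂ} {β C₀ : ℝ} (hβ0 : 0 < β) (hC : 0 < C₀)
    (hf : IsHydroPair K f g) (hH : IsHolder f β C₀) {x₀ r : ℝ} (hr : 0 < r)
    (hK : K ⊆ closedBall (x₀ : ℂ) r) {z : ℂ} (hz : z ∈ UHP) (hzr : 4 * r ≤ ‖z - x₀‖) :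
    ‖z - g z‖ ≤ 9 * r := by
  have h1 := im_le_im_f hf.1
  have h2 := J_im_f_le hβ0 hC hf hH hr hK
  obtain ⟨⟨hd, hi, himg, hlim⟩, hg⟩ := hf
  have hgd := inv_holo hd hi himg hg.1
  have ho : IsOpen (UHP \ K) := himg ▸ img_open hd hi _ Subset.rfl isOpen_UHP
  have hmem : ∀ z ∈ UHP, r < ‖z - x₀‖ → z ∈ UHP \ K := by
    intro z hz h
    refine ⟨hz, fun hzK => ?_⟩
    have := hK hzK
    rw [mem_closedBall, dist_eq_norm] at this
    linarith
  have hgU : ∀ z ∈ UHP \ K, g z ∈ UHP ∧ f (g z) = z := by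
    intro z hz
    refine ⟨?_, hg.2 hz⟩
    obtain ⟨w, hw, rfl⟩ := (himg ▸ hz : z ∈ f '' UHP)
    rwa [hg.1 hw]
  let G : ℂ → ℂ := fun z => z - g z
  have hG0 : ∀ z ∈ UHP \ K, 0 ≤ (G z).im := by
    intro z hz
    have := h1 (g z) (hgU z hz).1
    rw [(hgU z hz).2] at this
    simp [G]; linarith
  have hG1 : ∀ z ∈ UHP \ K, (G z).im ≤ z.im * r^2 / ‖z - x₀‖^2 := by
    intro z hz
    have := h2 (g z) (hgU z hz).1
    rw [(hgU z hz).2] at this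
    simp only [G, Complex.sub_im]
    have h3 : z.im * (1 - r^2 / ‖z - x₀‖^2) = z.im - z.im * r^2 / ‖z - x₀‖^2 := by ring
    linarith
  have hGd : ∀ z ∈ UHP \ K, DifferentiableAt ℂ G z := fun z hz =>
    differentiableAt_id.sub (hgd.differentiableAt (ho.mem_nhds hz))
  have hder : ∀ z ∈ UHP, 4 * r ≤ ‖z - x₀‖ → ‖deriv G z‖ ≤ 36 * r^2 / ‖z - x₀‖^2 := by
    intro z hz hzr
    have hz0 : 0 < z.im := hz
    have hn0 : 0 < ‖z - x₀‖ := by linarith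
    have himn : z.im ≤ ‖z - x₀‖ := by
      have := Complex.abs_im_le_norm (z - x₀)
      simp at this
      exact (le_abs_self _).trans this
    have hball : ∀ ζ ∈ closedBall z (z.im / 2),
        ζ ∈ UHP \ K ∧ ζ.im ≤ 3 / 2 * z.im ∧ ‖z - x₀‖ / 2 ≤ ‖ζ - x₀‖ := by
      intro ζ hζ
      rw [mem_closedBall, dist_eq_norm] at hζ
      have h3 := Complex.abs_im_le_norm (ζ - z)
      rw [Complex.sub_im] at h3
      have h4 := abs_le.1 (h3.trans hζ)
      have h5 : ‖z - x₀‖ ≤ ‖ζ - x₀‖ + ‖ζ - z‖ := by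
        have := norm_sub_le (ζ - x₀) (ζ - z)
        simpa using this
      have h6 : ‖z - x₀‖ / 2 ≤ ‖ζ - x₀‖ := by linarith
      refine ⟨hmem ζ ?_ (by linarith), by linarith, h6⟩
      show 0 < ζ.im
      linarith
    have hM : 0 < 6 * z.im * r^2 / ‖z - x₀‖^2 := by positivity
    have := deriv_le_of_im (F := G) (z := z) (ρ := z.im / 2) (M := 6 * z.im * r^2 / ‖z - x₀‖^2)
      (by linarith) hM (fun ζ hζ => hGd ζ (hball ζ hζ).1) (fun ζ hζ => hG0 ζ (hball ζ hζ).1) (by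
        intro ζ hζ
        obtain ⟨ha, hb, hc⟩ := hball ζ hζ
        refine (hG1 ζ ha).trans ?_
        have h7 : (‖z - x₀‖/2)^2 ≤ ‖ζ - x₀‖^2 := by gcongr
        calc ζ.im * r^2 / ‖ζ - x₀‖^2 ≤ (3 / 2 * z.im) * r^2 / (‖z - x₀‖/2)^2 := by gcongr
          _ = _ := by field_simp; ring)
    refine this.trans (le_of_eq ?_)
    field_simp
    ring
  -- integrate along the ray
  set v : ℂ := z - x₀ with hv
  have hv0 : 0 < ‖v‖ := by linarith
  have hray : ∀ t : ℝ, 1 ≤ t → (x₀ + t * v ∈ UHP) ∧ ‖(x₀ + t * v : ℂ) - x₀‖ = t * ‖v‖ := by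
    intro t ht
    constructor
    · have hz0 : 0 < z.im := hz
      show 0 < (x₀ + t * v : ℂ).im
      simp [hv]
      positivity
    · rw [add_sub_cancel_left, norm_mul, Complex.norm_real, Real.norm_eq_abs, abs_of_pos (by linarith)]
  have hrayr : ∀ t : ℝ, 1 ≤ t → 4 * r ≤ ‖(x₀ + t * v : ℂ) - x₀‖ := by
    intro t ht
    rw [(hray t ht).2]
    nlinarith
  have hrayK : ∀ t : ℝ, 1 ≤ t → (x₀ + t * v : ℂ) ∈ UHP \ K := fun t ht =>
    hmem _ (hray t ht).1 (by linarith [hrayr t ht])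
  set k : ℝ := 36 * r^2 / ‖v‖ with hk
  have hbound : ∀ T : ℝ, 1 ≤ T → ‖G (x₀ + T * v) - G z‖ ≤ k := by
    intro T hT
    have hderiv : ∀ t : ℝ, 1 ≤ t → HasDerivAt (fun t : ℝ => G (x₀ + t * v) - G z)
        (deriv G (x₀ + t * v) * v) t := by
      intro t ht
      have ha : HasDerivAt (fun t : ℝ => (x₀ + t * v : ℂ)) v t := by
        have := (((hasDerivAt_id t).ofReal_comp).mul_const v).const_add (x₀ : ℂ)
        simpa using this
      exact (((hGd _ (hrayK t ht)).hasDerivAt).comp t ha).sub_const _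
    have := image_norm_le_of_norm_deriv_right_le_deriv_boundary'
      (f := fun t : ℝ => G (x₀ + t * v) - G z) (a := 1) (b := T)
      (f' := fun t => deriv G (x₀ + t * v) * v)
      (B := fun t => k * (1 - t⁻¹)) (B' := fun t => k * (t^2)⁻¹)
      (fun t ht => (hderiv t ht.1).continuousAt.continuousWithinAt)
      (fun t ht => (hderiv t ht.1).hasDerivWithinAt)
      (by simp [hv])
      (by
        intro t ht
        have : t ≠ 0 := by linarith [ht.1]
        exact (continuousAt_const.mul (continuousAt_const.sub (continuousAt_inv₀ this))).continuousWithinAt)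
      (by
        intro t ht
        have h0 : t ≠ 0 := by linarith [ht.1]
        have := ((hasDerivAt_inv h0).const_sub 1).const_mul k
        simpa using this.hasDerivWithinAt)
      (by
        intro t ht
        have h0 : 0 < t := by linarith [ht.1]
        rw [norm_mul]
        have := hder _ (hray t ht.1).1 (hrayr t ht.1)
        rw [(hray t ht.1).2] at this
        refine (mul_le_mul_of_nonneg_right this hv0.le).trans (le_of_eq ?_)
        rw [hk]
        field_simp)
      (right_mem_Icc.2 hT)
    refine this.trans ?_
    have hk0 : 0 ≤ k := by positivity
    have : 0 ≤ T⁻¹ := by positivity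
    nlinarith
  -- let T go to infinity
  have hfin : ‖G z‖ ≤ k := by
    refine le_of_forall_pos_le_add fun ε hε => ?_
    have h3 : ∀ᶠ w in cobounded ℂ ⊓ 𝓟 UHP, ‖f w - w‖ < ε := by
      have := hlim.norm
      rw [norm_zero] at this
      exact this.eventually (gt_mem_nhds hε)
    rw [eventually_inf_principal] at h3
    obtain ⟨R, -, hR⟩ := (hasBasis_cobounded_norm (E := ℂ)).eventually_iff.1 h3
    obtain ⟨M, hM⟩ := f_bdd hβ0 hC hH R
    set T : ℝ := max 1 ((|M| + |x₀| + 1) / ‖v‖) with hT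
    have hT1 : 1 ≤ T := le_max_left _ _
    have hTv : |M| + |x₀| + 1 ≤ T * ‖v‖ := by
      rw [← div_le_iff₀ hv0]; exact le_max_right _ _
    have hU := hgU _ (hrayK T hT1)
    have hbig : R < ‖g (x₀ + T * v)‖ := by
      by_contra! h
      have h4 := hM _ hU.1 h
      rw [hU.2] at h4
      have h5 := norm_sub_le (x₀ + T * v : ℂ) x₀
      rw [(hray T hT1).2, Complex.norm_real, Real.norm_eq_abs] at h5
      linarith [le_abs_self M]
    have h6 := hR hbig.le hU.1
    rw [hU.2] at h6
    have h7 := norm_sub_le (G (x₀ + T * v)) (G (x₀ + T * v) - G z)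
    rw [sub_sub_cancel] at h7
    have h8 : ‖G (x₀ + T * v)‖ < ε := h6
    linarith [hbound T hT1]
  refine hfin.trans ?_
  rw [hk, div_le_iff₀ hv0]
  nlinarith

lemma preimage_near {K : Set ℂ} {f g : ℂ → ℂ} {β C₀ : ℝ} (hβ0 : 0 < β) (hC : 0 < C₀)
    (hf : IsHydroPair K f g) (hH : IsHolder f β C₀) {x₀ r : ℝ} (hr : 0 < r)
    (hK : K ⊆ closedBall (x₀ : ℂ) r) {w : ℂ} (hw : w ∈ UHP) (hwr : ‖f w - x₀‖ < 4 * r) :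
    ‖w - x₀‖ ≤ 13 * r := by
  have hnear := fun z hz => g_near_id hβ0 hC hf hH hr hK (z := z) hz
  obtain ⟨⟨hd, hi, himg, hlim⟩, hg⟩ := hf
  by_contra! hlt
  set v : ℂ := w - x₀ with hv
  have hv0 : 0 < ‖v‖ := by linarith
  have hray : ∀ t : ℝ, 1 ≤ t → (x₀ + t * v ∈ UHP) ∧ ‖(x₀ + t * v : ℂ) - x₀‖ = t * ‖v‖ := by
    intro t ht
    constructor
    · have hz0 : 0 < w.im := hw
      show 0 < (x₀ + t * v : ℂ).im
      simp [hv]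
      positivity
    · rw [add_sub_cancel_left, norm_mul, Complex.norm_real, Real.norm_eq_abs, abs_of_pos (by linarith)]
  have h3 : ∀ᶠ w in cobounded ℂ ⊓ 𝓟 UHP, ‖f w - w‖ < r := by
    have := hlim.norm
    rw [norm_zero] at this
    exact this.eventually (gt_mem_nhds hr)
  rw [eventually_inf_principal] at h3
  obtain ⟨R, -, hR⟩ := (hasBasis_cobounded_norm (E := ℂ)).eventually_iff.1 h3
  set T : ℝ := max 1 ((|R| + |x₀| + 5 * r + 1) / ‖v‖) with hT
  have hT1 : 1 ≤ T := le_max_left _ _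
  have hTv : |R| + |x₀| + 5 * r + 1 ≤ T * ‖v‖ := by
    rw [← div_le_iff₀ hv0]; exact le_max_right _ _
  have hbig : R < ‖(x₀ + T * v : ℂ)‖ := by
    have h5 := norm_sub_le (x₀ + T * v : ℂ) x₀
    rw [(hray T hT1).2, Complex.norm_real, Real.norm_eq_abs] at h5
    linarith [le_abs_self R]
  have h6 := hR hbig.le (hray T hT1).1
  have hend : 4 * r ≤ ‖f (x₀ + T * v) - x₀‖ := by
    have h7 : ‖(x₀ + T * v : ℂ) - x₀‖ ≤ ‖f (x₀ + T * v) - x₀‖ + ‖f (x₀ + T * v) - (x₀ + T * v)‖ := by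
      have := norm_sub_le (f (x₀ + T * v) - x₀) (f (x₀ + T * v) - (x₀ + T * v))
      simpa using this
    rw [(hray T hT1).2] at h7
    linarith [abs_nonneg R, abs_nonneg x₀]
  have hcont : ContinuousOn (fun t : ℝ => ‖f (x₀ + t * v) - x₀‖) (Icc 1 T) := by
    have : ContinuousOn (fun t : ℝ => f (x₀ + t * v)) (Icc 1 T) :=
      hd.continuousOn.comp (by fun_prop) (fun t ht => (hray t ht.1).1)
    exact (this.sub continuousOn_const).norm
  obtain ⟨t, ht, hft⟩ := intermediate_value_Icc hT1 hcont (show 4 * r ∈ Icc _ _ from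
    ⟨by simpa [hv] using hwr.le, hend⟩)
  have hft' : ‖f (x₀ + t * v) - x₀‖ = 4 * r := hft
  have hfU : f (x₀ + t * v) ∈ UHP :=
    (himg ▸ mem_image_of_mem f (hray t ht.1).1 : f (x₀ + t * v) ∈ UHP \ K).1
  have h8 := hnear _ hfU hft'.ge
  rw [hg.1 (hray t ht.1).1] at h8
  have h9 : ‖(x₀ + t * v : ℂ) - x₀‖ ≤ ‖f (x₀ + t * v) - x₀‖ + ‖f (x₀ + t * v) - (x₀ + t * v)‖ := by
    have := norm_sub_le (f (x₀ + t * v) - x₀) (f (x₀ + t * v) - (x₀ + t * v))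
    simpa using this
  rw [(hray t ht.1).2, hft'] at h9
  nlinarith [ht.1]

lemma delta_le {K : Set ℂ} {f g : ℂ → ℂ} {β C₀ : ℝ} (hβ0 : 0 < β) (hC : 0 < C₀)
    (hf : IsHydroPair K f g) (hH : IsHolder f β C₀) {w : ℂ} (hw : w ∈ UHP) :
    infDist (f w) (frontier (UHP \ K)) ≤ C₀ * max (w.im ^ β) w.im := by
  by_contra! hlt
  have hf' := hf
  obtain ⟨⟨hd, hi, himg, hlim⟩, hg⟩ := hf
  have ho : IsOpen (UHP \ K) := himg ▸ img_open hd hi _ Subset.rfl isOpen_UHP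
  have hw0 : 0 < w.im := hw
  set ρ := C₀ * max (w.im ^ β) w.im with hρ
  have hρ0 : 0 < ρ := mul_pos hC (lt_max_of_lt_right hw0)
  have hfw : f w ∈ UHP \ K := himg ▸ mem_image_of_mem f hw
  have hball : closedBall (f w) ρ ⊆ UHP \ K := by
    refine (convex_closedBall (f w) ρ).isPreconnected.subset_of_closure_inter_subset ho
      ⟨f w, mem_closedBall_self hρ0.le, hfw⟩ ?_
    rintro z ⟨hz1, hz2⟩
    by_contra hz
    have hzf : z ∈ frontier (UHP \ K) := by
      rw [frontier, ho.interior_eq]; exact ⟨hz1, hz⟩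
    have := infDist_le_dist_of_mem (x := f w) hzf
    rw [mem_closedBall, dist_comm] at hz2
    linarith
  have hx : ((w.re : ℂ)).im = 0 := by simp
  have hev := f_leaves_compact hf' (isCompact_closedBall (f w) ρ) hball hx
  have htend : Tendsto (fun t : ℝ => (w.re + t * I : ℂ)) (nhdsWithin 0 (Ioi 0))
      (nhdsWithin (w.re : ℂ) UHP) := by
    rw [tendsto_nhdsWithin_iff]
    constructor
    · have : Continuous (fun t : ℝ => (w.re + t * I : ℂ)) := by fun_prop
      have h2 := this.tendsto 0
      simp only [Complex.ofReal_zero, zero_mul, add_zero] at h2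
      exact h2.mono_left nhdsWithin_le_nhds
    · filter_upwards [self_mem_nhdsWithin] with t ht
      show 0 < (w.re + t * I : ℂ).im
      simpa using ht
  have h1 := htend.eventually hev
  have h2 : ∀ᶠ t : ℝ in nhdsWithin 0 (Ioi 0), t < w.im :=
    nhdsWithin_le_nhds (gt_mem_nhds hw0)
  obtain ⟨t, ⟨ht1, ht2⟩, ht0⟩ := ((h1.and h2).and self_mem_nhdsWithin).exists
  have ht0' : 0 < t := ht0
  apply ht1
  have htU : (w.re + t * I : ℂ) ∈ UHP := by
    show 0 < (w.re + t * I : ℂ).im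
    simpa using ht0'
  have hdist : dist (w.re + t * I : ℂ) w ≤ w.im := by
    have : (w.re + t * I : ℂ) - w = ((t - w.im : ℝ) : ℂ) * I := by
      apply Complex.ext <;> simp
    rw [dist_eq_norm, this, norm_mul, Complex.norm_real, Complex.norm_I, mul_one,
      Real.norm_eq_abs, abs_le]
    constructor <;> linarith
  rw [mem_closedBall]
  refine (hH _ htU w hw).trans ?_
  refine mul_le_mul_of_nonneg_left (max_le_max ?_ hdist) hC.le
  exact Real.rpow_le_rpow dist_nonneg hdist hβ0.le

lemma geod_mul {a w b : ℂ} (ha : a ∈ UHP) (hw : w ∈ UHP) (hb : b ∈ UHP)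
    (h : rhoH a w + rhoH w b = rhoH a b) : dist a w * dist w b ≤ w.im * dist a b := by
  have ha0 : 0 < a.im := ha
  have hw0 : 0 < w.im := hw
  have hb0 : 0 < b.im := hb
  unfold rhoH at h
  set s := dist a w / (2 * Real.sqrt (a.im * w.im)) with hs
  set t := dist w b / (2 * Real.sqrt (w.im * b.im)) with ht
  set u := dist a b / (2 * Real.sqrt (a.im * b.im)) with hu
  have hs0 : 0 ≤ s := by positivity
  have ht0 : 0 ≤ t := by positivity
  have h1 : Real.arsinh s + Real.arsinh t = Real.arsinh u := by linarith
  have h2 : u = s * √(1 + t^2) + √(1 + s^2) * t := by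
    have := congrArg Real.sinh h1
    rw [Real.sinh_add, Real.sinh_arsinh, Real.sinh_arsinh, Real.sinh_arsinh, Real.cosh_arsinh,
      Real.cosh_arsinh] at this
    exact this.symm
  have h3 : t ≤ √(1 + t^2) := Real.le_sqrt_of_sq_le (by linarith)
  have h4 : s ≤ √(1 + s^2) := Real.le_sqrt_of_sq_le (by linarith)
  have h5 : 2 * (s * t) ≤ u := by
    rw [h2]
    have := mul_le_mul_of_nonneg_left h3 hs0
    have := mul_le_mul_of_nonneg_right h4 ht0
    linarith
  rw [hs, ht, hu, Real.sqrt_mul ha0.le, Real.sqrt_mul hw0.le, Real.sqrt_mul ha0.le] at h5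
  have qa := Real.sqrt_pos.2 ha0
  have qw := Real.sqrt_pos.2 hw0
  have qb := Real.sqrt_pos.2 hb0
  have h6 : 2 * (dist a w / (2 * (√a.im * √w.im)) * (dist w b / (2 * (√w.im * √b.im))))
      = (dist a w * dist w b) / (w.im * (2 * (√a.im * √b.im))) := by
    have : w.im = √w.im * √w.im := (Real.mul_self_sqrt hw0.le).symm
    rw [this]
    field_simp
    try simp
  rw [h6, div_le_div_iff₀ (by positivity) (by positivity)] at h5
  have h7 : 0 < 2 * (√a.im * √b.im) := by positivity
  have h8 : (dist a w * dist w b) * (2 * (√a.im * √b.im))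
      ≤ (w.im * dist a b) * (2 * (√a.im * √b.im)) := by linarith
  exact le_of_mul_le_mul_right h8 h7

lemma geod_dist {a w b : ℂ} (ha : a ∈ UHP) (hw : w ∈ UHP) (hb : b ∈ UHP)
    (h : rhoH a w + rhoH w b = rhoH a b) : dist a w ≤ 2 * dist a b + a.im := by
  have h1 := geod_mul ha hw hb h
  have ha0 : 0 < a.im := ha
  have h2 : w.im ≤ a.im + dist a w := by
    have := Complex.abs_im_le_norm (a - w)
    rw [← dist_eq_norm, Complex.sub_im, abs_le] at this
    linarith [this.1]
  have h3 : dist a w ≤ dist a b + dist w b := by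
    have := dist_triangle a b w
    rwa [dist_comm b w] at this
  by_contra! hlt
  have hD : 0 ≤ dist a b := dist_nonneg
  have h4 : dist a w * (dist a w - dist a b) ≤ dist a w * dist w b :=
    mul_le_mul_of_nonneg_left (by linarith) dist_nonneg
  have h5 : w.im * dist a b ≤ (a.im + dist a w) * dist a b :=
    mul_le_mul_of_nonneg_right h2 hD
  nlinarith

lemma rho_le {a w : ℂ} {d : ℝ} (hd : 0 < d) (hw : w ∈ UHP)
    (ha1 : 100 * d ≤ a.im) (hR : dist a w ≤ 800 * d) (hy : w.im ≤ 1024 * d) :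
    rhoH a w ≤ 2 * Real.log 112 + Real.log (d / w.im) := by
  have hw0 : 0 < w.im := hw
  have ha0 : 0 < a.im := by linarith
  unfold rhoH
  set s := dist a w / (2 * √(a.im * w.im)) with hs
  have hs0 : 0 ≤ s := by positivity
  have hq : 0 < √(d / w.im) := Real.sqrt_pos.2 (by positivity)
  have h1 : Real.exp (Real.arsinh s) ≤ 2 * s + 1 := by
    rw [Real.exp_arsinh]
    have : √(1 + s^2) ≤ 1 + s := Real.sqrt_le_iff.2 ⟨by linarith, by nlinarith⟩
    linarith
  have h2 : 2 * s ≤ 80 * √(d / w.im) := by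
    have e1 : 10 * √(d * w.im) ≤ √(a.im * w.im) := by
      have : (10:ℝ) = √100 := by
        rw [show (100:ℝ) = 10^2 by norm_num, Real.sqrt_sq (by norm_num)]
      rw [this, ← Real.sqrt_mul (by norm_num)]
      apply Real.sqrt_le_sqrt
      nlinarith
    have e2 : 0 < √(d * w.im) := Real.sqrt_pos.2 (by positivity)
    have e3 : √(d / w.im) = d / √(d * w.im) := by
      rw [eq_div_iff e2.ne', ← Real.sqrt_mul (by positivity)]
      rw [show d / w.im * (d * w.im) = d^2 by field_simp, Real.sqrt_sq hd.le]
    have e4 : 2 * s = dist a w / √(a.im * w.im) := by rw [hs]; field_simp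
    rw [e3, e4]
    calc dist a w / √(a.im * w.im) ≤ (800 * d) / (10 * √(d * w.im)) := by gcongr
      _ = _ := by field_simp; norm_num
  have h3 : 1 ≤ 32 * √(d / w.im) := by
    have e1 : (1/32:ℝ) ≤ √(d / w.im) := by
      apply Real.le_sqrt_of_sq_le
      rw [le_div_iff₀ hw0]
      linarith
    linarith
  have h4 : Real.exp (Real.arsinh s) ≤ 112 * √(d / w.im) := by linarith
  have h5 := (Real.le_log_iff_exp_le (by positivity)).2 h4
  rw [Real.log_mul (by norm_num) hq.ne', Real.log_sqrt (by positivity)] at h5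
  linarith

lemma log_final {β C₀ d y δ : ℝ} (hβ0 : 0 < β) (hβ1 : β ≤ 1) (hC : 0 < C₀) (hd : 0 < d)
    (hy : 0 < y) (hyd : y ≤ 1024 * d) (hδ : 0 < δ) (h : δ ≤ C₀ * max (y ^ β) y) :
    Real.log (d / y) ≤ (1/β) * Real.log (max (d ^ β) d / δ) + (1/β) * Real.log (1024 * C₀) := by
  set m := max (d ^ β) d with hm
  have hm0 : 0 < m := lt_max_of_lt_right hd
  have ht0 : 0 < y / d := by positivity
  have ht1 : y / d ≤ 1024 := by rw [div_le_iff₀ hd]; exact hyd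
  have htb : 0 < (y / d) ^ β := Real.rpow_pos_of_pos ht0 _
  have h1 : y ^ β ≤ 1024 * m * (y / d) ^ β := by
    have : y ^ β = d ^ β * (y / d) ^ β := by
      rw [← Real.mul_rpow hd.le ht0.le]; congr 1; field_simp
    rw [this]
    apply mul_le_mul_of_nonneg_right _ htb.le
    have : d ^ β ≤ m := le_max_left _ _
    linarith
  have h2 : y ≤ 1024 * m * (y / d) ^ β := by
    have e1 : y / d = (y / d) ^ β * (y / d) ^ (1 - β) := by
      rw [← Real.rpow_add ht0]; simp
    have e2 : (y / d) ^ (1 - β) ≤ 1024 := by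
      calc (y / d) ^ (1 - β) ≤ 1024 ^ (1 - β) := Real.rpow_le_rpow ht0.le ht1 (by linarith)
        _ ≤ 1024 ^ (1:ℝ) := Real.rpow_le_rpow_of_exponent_le (by norm_num) (by linarith)
        _ = 1024 := by simp
    have e3 : y / d ≤ (y / d) ^ β * 1024 := by
      conv_lhs => rw [e1]
      exact mul_le_mul_of_nonneg_left e2 htb.le
    have e4 : y = d * (y / d) := by field_simp
    have e5 : d ≤ m := le_max_right _ _
    calc y = d * (y / d) := e4
      _ ≤ m * ((y / d) ^ β * 1024) := by gcongr
      _ = _ := by ring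
  have h3 : δ ≤ C₀ * (1024 * m * (y / d) ^ β) :=
    h.trans (mul_le_mul_of_nonneg_left (max_le h1 h2) hC.le)
  have h4 := Real.log_le_log hδ h3
  rw [show C₀ * (1024 * m * (y / d) ^ β) = (1024 * C₀) * (m * (y / d) ^ β) by ring,
    Real.log_mul (by positivity) (by positivity), Real.log_mul hm0.ne' htb.ne',
    Real.log_rpow ht0] at h4
  have h5 : Real.log (d / y) = - Real.log (y / d) := by
    rw [← Real.log_inv, inv_div]
  rw [h5, Real.log_div hm0.ne' hδ.ne', ← mul_add, one_div, inv_mul_eq_div, le_div_iff₀ hβ0]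
  linarith

/-- **Lemma `hypgrowth`.** In a Hölder domain `Ω = ℍ \ K` there is a
base-point `z₀` from which the hyperbolic distance grows at most logarithmically along
hyperbolic geodesics to points of `D_K = {w ∈ Ω : dist(w,K) ≤ 100 diam K}`. -/
theorem holder_domain_hyperbolic_growth (β C₀ : ℝ) (hβ0 : 0 < β) (hβ1 : β ≤ 1)
    (hC₀ : 0 < C₀) :
    ∃ C > 0, ∀ (K : Set ℂ) (f g : ℂ → ℂ),
      IsHull K → K.Nonempty → IsHydroPair K f g → IsHolder f β C₀ →
      ∃ z₀ ∈ UHP \ K,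
        infDist z₀ K ≤ 200 * Metric.diam K ∧ 100 * Metric.diam K ≤ z₀.im ∧
        ∀ z ∈ UHP \ K,
          (∃ z₁ ∈ UHP \ K, infDist z₁ K ≤ 100 * Metric.diam K ∧
            rhoVia f z₀ z + rhoVia f z z₁ = rhoVia f z₀ z₁) →
          rhoVia f z₀ z ≤
            (1/β) * Real.log (max (Metric.diam K ^ β) (Metric.diam K) /
              infDist z (frontier (UHP \ K))) + C := by
  refine ⟨2 * Real.log 112 + |(1/β) * Real.log (1024 * C₀)|, ?_, ?_⟩
  · have : 0 < Real.log 112 := Real.log_pos (by norm_num)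
    positivity
  intro K f g hK hKne hfg hH
  obtain ⟨p, hp⟩ := hKne
  set d := Metric.diam K with hd
  have hpd : p.im ≤ d := hull_im_le hK hp
  have hp0 : 0 < p.im := hK.2.1 hp
  have hd0 : 0 < d := by linarith
  have hr : 0 < 2 * d := by linarith
  have hKb : K ⊆ closedBall ((p.re : ℝ) : ℂ) (2 * d) := by
    intro q hq
    have h1 : dist q p ≤ d := Metric.dist_le_diam_of_mem hK.1 hq hp
    have h2 : dist p (p.re : ℂ) = p.im := by
      have : p - (p.re : ℂ) = (p.im : ℂ) * I := by apply Complex.ext <;> simp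
      rw [dist_eq_norm, this, norm_mul, Complex.norm_I, Complex.norm_real, Real.norm_eq_abs,
        abs_of_pos hp0, mul_one]
    rw [mem_closedBall]
    linarith [dist_triangle q p (p.re : ℂ)]
  set x₀ : ℝ := p.re with hx₀
  have hnear := fun z hz => g_near_id hβ0 hC₀ hfg hH hr hKb (z := z) hz
  have hinner := fun w hw => preimage_near hβ0 hC₀ hfg hH hr hKb (w := w) hw
  have hdelta := fun w hw => delta_le hβ0 hC₀ hfg hH (w := w) hw
  obtain ⟨⟨hdf, hi, himg, hlim⟩, hg⟩ := hfg
  have ho : IsOpen (UHP \ K) := himg ▸ img_open hdf hi _ Subset.rfl isOpen_UHP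
  have hinv : ∀ w ∈ UHP, invFunOn f UHP (f w) = w := fun w hw => hi.leftInvOn_invFunOn hw
  -- the base point
  set z₀ : ℂ := x₀ + (150 * d : ℝ) * I with hz₀
  have hz₀n : ‖z₀ - x₀‖ = 150 * d := by
    rw [hz₀, add_sub_cancel_left, norm_mul, Complex.norm_I, Complex.norm_real, Real.norm_eq_abs,
      abs_of_pos (by linarith), mul_one]
  have hz₀im : z₀.im = 150 * d := by simp [hz₀]
  have hz₀U : z₀ ∈ UHP := by
    show 0 < z₀.im
    rw [hz₀im]; linarith
  have hz₀K : z₀ ∈ UHP \ K := by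
    refine ⟨hz₀U, fun h => ?_⟩
    have := hull_im_le hK h
    rw [hz₀im] at this
    linarith
  refine ⟨z₀, hz₀K, ?_, by rw [hz₀im]; linarith, ?_⟩
  · refine (infDist_le_dist_of_mem hp).trans ?_
    have : z₀ - p = ((150 * d - p.im : ℝ) : ℂ) * I := by
      apply Complex.ext <;> simp [hz₀, hx₀]
    rw [dist_eq_norm, this, norm_mul, Complex.norm_I, Complex.norm_real, Real.norm_eq_abs,
      abs_of_pos (by linarith), mul_one]
    linarith
  rintro z hz ⟨z₁, hz₁, hz₁K, hgeo⟩
  obtain ⟨w, hw, rfl⟩ := (himg ▸ hz : z ∈ f '' UHP)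
  obtain ⟨w₁, hw₁, rfl⟩ := (himg ▸ hz₁ : z₁ ∈ f '' UHP)
  obtain ⟨w₀, hw₀, hw₀z⟩ := (himg ▸ hz₀K : z₀ ∈ f '' UHP)
  have hn0 := hnear z₀ hz₀U (by rw [hz₀n]; linarith)
  rw [← hw₀z] at hgeo ⊢
  unfold rhoVia at hgeo ⊢
  rw [hinv w hw, hinv w₀ hw₀, hinv w₁ hw₁] at hgeo
  rw [hinv w hw, hinv w₀ hw₀]
  rw [← hw₀z, hg.1 hw₀, hw₀z] at hn0
  have hw₀im : 100 * d ≤ w₀.im ∧ w₀.im ≤ 168 * d := by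
    have := (Complex.abs_im_le_norm (z₀ - w₀)).trans hn0
    rw [Complex.sub_im, hz₀im, abs_le] at this
    constructor <;> linarith [this.1, this.2]
  have hw₀x : ‖w₀ - x₀‖ ≤ 168 * d := by
    have := norm_sub_le (z₀ - x₀) (z₀ - w₀)
    rw [hz₀n] at this
    rw [show z₀ - x₀ - (z₀ - w₀) = w₀ - x₀ by ring] at this
    linarith
  have hz₁x : ‖f w₁ - x₀‖ ≤ 103 * d := by
    obtain ⟨q, hq, hqd⟩ := (infDist_lt_iff ⟨p, hp⟩).1
      (lt_of_le_of_lt hz₁K (by linarith : 100 * d < 101 * d))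
    have := hKb hq
    rw [mem_closedBall] at this
    rw [← dist_eq_norm]
    linarith [dist_triangle (f w₁) q (x₀ : ℂ)]
  have hw₁x : ‖w₁ - x₀‖ ≤ 121 * d := by
    by_cases hc : ‖f w₁ - x₀‖ < 4 * (2 * d)
    · have := hinner w₁ hw₁ hc
      linarith
    · have h1 := hnear (f w₁) hz₁.1 (not_lt.1 hc)
      rw [hg.1 hw₁] at h1
      have := norm_sub_le (f w₁ - x₀) (f w₁ - w₁)
      rw [show f w₁ - x₀ - (f w₁ - w₁) = w₁ - x₀ by ring] at this
      linarith
  have hD : dist w₀ w₁ ≤ 289 * d := by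
    rw [dist_eq_norm]
    have := norm_sub_le (w₀ - x₀) (w₁ - x₀)
    rw [sub_sub_sub_cancel_right] at this
    linarith
  have hR : dist w₀ w ≤ 800 * d := by
    have := geod_dist hw₀ hw hw₁ hgeo
    linarith [hw₀im.2]
  have hy : w.im ≤ 1024 * d := by
    have := Complex.abs_im_le_norm (w₀ - w)
    rw [← dist_eq_norm, Complex.sub_im, abs_le] at this
    linarith [this.1, hw₀im.2]
  have hfr : (frontier (UHP \ K)).Nonempty := by
    rw [nonempty_frontier_iff]
    refine ⟨⟨_, hz⟩, fun h => ?_⟩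
    have h0 : (0:ℂ) ∈ UHP := (h.symm ▸ mem_univ (0:ℂ) : (0:ℂ) ∈ UHP \ K).1
    have h1 : (0:ℝ) < (0:ℂ).im := h0
    simp at h1
  have hδ : 0 < infDist (f w) (frontier (UHP \ K)) := by
    rw [← isClosed_frontier.notMem_iff_infDist_pos hfr, ho.frontier_eq]
    exact fun h => h.2 hz
  have h1 := rho_le hd0 hw hw₀im.1 hR hy
  have h2 := log_final hβ0 hβ1 hC₀ hd0 hw hy hδ (hdelta w hw)
  have h3 := le_abs_self ((1/β) * Real.log (1024 * C₀))
  linarith
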